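/- arXiv:2512.02146 — 2 statements merged into one kernel-verified Lean document; each statement's English description precedes it below -/
import Mathlib

section
/- Let d ≥ 1 and let A ⊆ ℝ^d be a bounded infinite set. Suppose there exists a sequence {A_n}_{n=1}^∞ of finite subsets of A∖{0}, each with at least two elements, such that #A_n → ∞ and (−log δ(A_n))/#A_n → 0. Then for every α with 0 < α < 1 there exists a sequence {E_n}_{n=1}^∞ of open subsets of [0,1]^d such that lim_{n→∞} μ(E_n) = 1 and lim_{n→∞} μ*(V_n) = 0, where V_n := { x ∈ [0,1]^d : there exists T ∈ S_α^{1/α} such that TA + x ⊆ E_n } and μ* is the Lebesgue outer measure on ℝ^d. -/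
open MeasureTheory Filter Set

/-- The quantity `δ(F) = min{‖x−y‖ : x ≠ y ∈ F} / max{‖z‖ : z ∈ F}` for a finite set
`F ⊆ ℝ^d` with at least two elements. -/
noncomputable def delta {d : ℕ} (F : Set (EuclideanSpace ℝ (Fin d))) : ℝ :=
  sInf {s : ℝ | ∃ x ∈ F, ∃ y ∈ F, x ≠ y ∧ ‖x - y‖ = s} /
    sSup {s : ℝ | ∃ z ∈ F, ‖z‖ = s}

/-- The closed unit cube `[0,1]^d` in `ℝ^d`. -/
def unitCube (d : ℕ) : Set (EuclideanSpace ℝ (Fin d)) :=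
  {y | ∀ i, y i ∈ Set.Icc (0 : ℝ) 1}

/-- `‖T‖* = max_{‖u‖ = 1} ‖T u‖`. -/
noncomputable def opMax {d : ℕ}
    (T : EuclideanSpace ℝ (Fin d) →ₗ[ℝ] EuclideanSpace ℝ (Fin d)) : ℝ :=
  sSup {s : ℝ | ∃ u : EuclideanSpace ℝ (Fin d), ‖u‖ = 1 ∧ ‖T u‖ = s}

/-- `‖T‖_* = min_{‖u‖ = 1} ‖T u‖`. -/
noncomputable def opMin {d : ℕ}
    (T : EuclideanSpace ℝ (Fin d) →ₗ[ℝ] EuclideanSpace ℝ (Fin d)) : ℝ :=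
  sInf {s : ℝ | ∃ u : EuclideanSpace ℝ (Fin d), ‖u‖ = 1 ∧ ‖T u‖ = s}

/-- Membership in `S_α^β`: an invertible linear map `T` with `α < ‖T‖_*` and `‖T‖* < β`. -/
def memS {d : ℕ} (α β : ℝ)
    (T : EuclideanSpace ℝ (Fin d) ≃ₗ[ℝ] EuclideanSpace ℝ (Fin d)) : Prop :=
  α < opMin (T : EuclideanSpace ℝ (Fin d) →ₗ[ℝ] EuclideanSpace ℝ (Fin d)) ∧
    opMax (T : EuclideanSpace ℝ (Fin d) →ₗ[ℝ] EuclideanSpace ℝ (Fin d)) < β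

/-- In a random subset `S` of `I` of density `q`, the probability of avoiding `P ⊆ I` is
`(1 - q) ^ #P`. -/
theorem sum_weight_disjoint {ι : Type*} [DecidableEq ι] (I P : Finset ι) (hP : P ⊆ I) (q : ℝ) :
    ∑ S ∈ I.powerset, (if Disjoint P S then q ^ S.card * (1 - q) ^ (I.card - S.card) else 0)
      = (1 - q) ^ P.card := by
  have hfilter : I.powerset.filter (fun S => Disjoint P S) = (I \ P).powerset := by
    ext S
    simp only [Finset.mem_filter, Finset.mem_powerset, Finset.subset_sdiff, disjoint_comm]
  rw [← Finset.sum_filter, hfilter]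
  have hc : (I \ P).card + P.card = I.card := Finset.card_sdiff_add_card_eq_card hP
  have : ∀ S ∈ (I \ P).powerset, q ^ S.card * (1 - q) ^ (I.card - S.card)
      = (1 - q) ^ P.card * (q ^ S.card * (1 - q) ^ ((I \ P).card - S.card)) := by
    intro S hS
    have := Finset.card_le_card (Finset.mem_powerset.1 hS)
    rw [show I.card - S.card = P.card + ((I \ P).card - S.card) by omega, pow_add]
    ring
  rw [Finset.sum_congr rfl this, ← Finset.mul_sum, Finset.sum_pow_mul_eq_add_pow]
  simp

/-- The expected size of a random subset of `I` of density `q` is `q * #I`. -/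
theorem sum_weight_mul_card {ι : Type*} [DecidableEq ι] (I : Finset ι) (q : ℝ) :
    ∑ S ∈ I.powerset, q ^ S.card * (1 - q) ^ (I.card - S.card) * (S.card : ℝ) = q * I.card := by
  have hcard : ∀ S ∈ I.powerset, q ^ S.card * (1 - q) ^ (I.card - S.card) * (S.card : ℝ)
      = ∑ c ∈ I, (q ^ S.card * (1 - q) ^ (I.card - S.card) -
        if Disjoint {c} S then q ^ S.card * (1 - q) ^ (I.card - S.card) else 0) := by
    intro S hS
    have hcongr : ∀ c ∈ I, (q ^ S.card * (1 - q) ^ (I.card - S.card) -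
        if Disjoint {c} S then q ^ S.card * (1 - q) ^ (I.card - S.card) else 0) =
        if c ∈ S then q ^ S.card * (1 - q) ^ (I.card - S.card) else 0 := by
      intro c _
      by_cases h : c ∈ S <;> simp [h]
    rw [Finset.sum_congr rfl hcongr, ← Finset.sum_filter, Finset.filter_mem_eq_inter,
      Finset.inter_eq_right.2 (Finset.mem_powerset.1 hS), Finset.sum_const, nsmul_eq_mul, mul_comm]
  rw [Finset.sum_congr rfl hcard, Finset.sum_comm]
  have : ∀ c ∈ I, ∑ S ∈ I.powerset, (q ^ S.card * (1 - q) ^ (I.card - S.card) -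
        if Disjoint {c} S then q ^ S.card * (1 - q) ^ (I.card - S.card) else 0) = q := by
    intro c hc
    rw [Finset.sum_sub_distrib, sum_weight_disjoint I {c} (by simpa using hc),
      Finset.sum_pow_mul_eq_add_pow]
    simp
  rw [Finset.sum_congr rfl this]
  simp [mul_comm]

/-- Some `S ⊆ I` does at least as well as a random subset of density `q`: its size, weighted by `v`,
plus the total measure of the points `x` with `P t x` disjoint from `S`, is at most the mean. -/
theorem exists_subset_small_avoidance {ι τ X : Type*} [DecidableEq ι] [MeasurableSpace X]
    (μ : Measure X) (U : Set X) (hU : MeasurableSet U) (hμU : μ U = 1)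
    (I : Finset ι) (K : Finset τ) (P : τ → X → Finset ι) (N : ℕ)
    (hPI : ∀ t ∈ K, ∀ x ∈ U, P t x ⊆ I) (hPN : ∀ t ∈ K, ∀ x ∈ U, (P t x).card = N)
    (hmeas : ∀ t S, MeasurableSet {x | Disjoint (P t x) S})
    (q v : ℝ) (hq0 : 0 ≤ q) (hq1 : q ≤ 1) :
    ∃ S ⊆ I, (S.card : ℝ) * v + ∑ t ∈ K, μ.real (U ∩ {x | Disjoint (P t x) S})
      ≤ q * I.card * v + K.card * (1 - q) ^ N := by
  set w : Finset ι → ℝ := fun S => q ^ S.card * (1 - q) ^ (I.card - S.card) with hw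
  have hwnn : ∀ S, 0 ≤ w S := fun S => by
    have : 0 ≤ 1 - q := by linarith
    positivity
  have hwsum : ∑ S ∈ I.powerset, w S = 1 := by
    simp only [hw, Finset.sum_pow_mul_eq_add_pow]; simp
  have : IsFiniteMeasure (μ.restrict U) := ⟨by simp [hμU]⟩
  have hUreal : μ.real U = 1 := by simp [measureReal_def, hμU]
  have hone : ∀ t ∈ K, ∑ S ∈ I.powerset, w S * μ.real (U ∩ {x | Disjoint (P t x) S})
      = (1 - q) ^ N := by
    intro t ht
    have h1 : ∀ S ∈ I.powerset, w S * μ.real (U ∩ {x | Disjoint (P t x) S})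
        = ∫ x in U, (if Disjoint (P t x) S then w S else 0) ∂μ := by
      intro S _
      have : (fun x => if Disjoint (P t x) S then w S else 0)
          = {x | Disjoint (P t x) S}.indicator (fun _ => w S) := by
        ext x; simp [Set.indicator_apply]
      rw [this, integral_indicator_const _ (hmeas t S), measureReal_restrict_apply (hmeas t S),
        Set.inter_comm, smul_eq_mul, mul_comm]
    rw [Finset.sum_congr rfl h1, ← integral_finsetSum]
    · rw [setIntegral_congr_fun (g := fun _ => (1 - q) ^ N) hU]
      · simp [hUreal]
      · intro x hx
        simp only [hw]
        rw [sum_weight_disjoint I _ (hPI t ht x hx), hPN t ht x hx]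
    · intro S _
      have : (fun x => if Disjoint (P t x) S then w S else 0)
          = {x | Disjoint (P t x) S}.indicator (fun _ => w S) := by
        ext x; simp [Set.indicator_apply]
      rw [this]
      exact (integrable_const _).indicator (hmeas t S)
  have hsum : ∑ S ∈ I.powerset,
      w S * ((S.card : ℝ) * v + ∑ t ∈ K, μ.real (U ∩ {x | Disjoint (P t x) S}))
      = q * I.card * v + K.card * (1 - q) ^ N := by
    simp only [mul_add, Finset.sum_add_distrib, Finset.mul_sum]
    rw [Finset.sum_comm, Finset.sum_congr rfl hone, ← sum_weight_mul_card I q, Finset.sum_mul]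
    simp [hw, mul_assoc]
  by_contra! hcon
  have hpos : ∃ S ∈ I.powerset, 0 < w S := by
    by_contra! h
    have := Finset.sum_nonpos h
    linarith
  obtain ⟨S₀, hS₀, hpos⟩ := hpos
  have := Finset.sum_lt_sum (s := I.powerset)
    (f := fun S => w S * (q * I.card * v + K.card * (1 - q) ^ N))
    (g := fun S => w S * ((S.card : ℝ) * v + ∑ t ∈ K, μ.real (U ∩ {x | Disjoint (P t x) S})))
    (fun S hS => mul_le_mul_of_nonneg_left (hcon S (Finset.mem_powerset.1 hS)).le (hwnn S))
    ⟨S₀, hS₀, mul_lt_mul_of_pos_left (hcon S₀ (Finset.mem_powerset.1 hS₀)) hpos⟩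
  rw [hsum, ← Finset.sum_mul, hwsum, one_mul] at this
  exact this.false

theorem EuclideanSpace.eq_sum_smul_single {d : ℕ} (y : EuclideanSpace ℝ (Fin d)) :
    y = ∑ i, y i • EuclideanSpace.single i (1 : ℝ) := by
  simpa using ((EuclideanSpace.basisFun (Fin d) ℝ).sum_repr y).symm

theorem EuclideanSpace.norm_le_card_mul {d : ℕ} (y : EuclideanSpace ℝ (Fin d)) (c : ℝ)
    (h : ∀ i, |y i| ≤ c) : ‖y‖ ≤ d * c := by
  rw [EuclideanSpace.eq_sum_smul_single y]
  refine (norm_sum_le _ _).trans ?_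
  refine (Finset.sum_le_sum (g := fun _ => c) fun i _ => ?_).trans (by simp)
  simpa [norm_smul] using h i

theorem EuclideanSpace.volume_setOf_forall_mem_Icc {d : ℕ} (a b : Fin d → ℝ) :
    volume {y : EuclideanSpace ℝ (Fin d) | ∀ i, y i ∈ Set.Icc (a i) (b i)}
      = ∏ i, ENNReal.ofReal (b i - a i) := by
  rw [← Real.volume_Icc_pi, ← (PiLp.volume_preserving_ofLp (Fin d)).measure_preimage
    measurableSet_Icc.nullMeasurableSet]
  congr 1
  ext y
  simp [Pi.le_def, forall_and]

theorem EuclideanSpace.volume_setOf_forall_mem_Ioo {d : ℕ} (a b : Fin d → ℝ) :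
    volume {y : EuclideanSpace ℝ (Fin d) | ∀ i, y i ∈ Set.Ioo (a i) (b i)}
      = ∏ i, ENNReal.ofReal (b i - a i) := by
  rw [← Real.volume_pi_Ioo, ← (PiLp.volume_preserving_ofLp (Fin d)).measure_preimage
    (MeasurableSet.univ_pi fun _ => measurableSet_Ioo).nullMeasurableSet]
  congr 1
  ext y
  simp [Set.mem_pi]

theorem Int.card_Icc_floor_neg_le {t : ℝ} (ht : 0 ≤ t) :
    ((Finset.Icc ⌊-t⌋ ⌊t⌋).card : ℝ) ≤ 2 * t + 2 := by
  have h1 : (⌊-t⌋ : ℝ) > -t - 1 := Int.sub_one_lt_floor _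
  have h2 : (⌊t⌋ : ℝ) ≤ t := Int.floor_le _
  have h3 : ⌊-t⌋ ≤ ⌊t⌋ := Int.floor_mono (by linarith)
  rw [Int.card_Icc]
  have : (((⌊t⌋ + 1 - ⌊-t⌋).toNat : ℤ) : ℝ) = ⌊t⌋ + 1 - ⌊-t⌋ := by
    rw [Int.toNat_of_nonneg (by omega)]; push_cast; ring
  rw [Int.cast_natCast] at this
  linarith

theorem Int.floor_mem_Icc_floor_of_abs_le {s t : ℝ} (h : |s| ≤ t) :
    ⌊s⌋ ∈ Finset.Icc ⌊-t⌋ ⌊t⌋ :=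
  Finset.mem_Icc.2 ⟨Int.floor_mono (abs_le.1 h).1, Int.floor_mono (abs_le.1 h).2⟩

/-- The linear map with matrix `h • k`, for an integer matrix `k`. -/
noncomputable def gridMap {d : ℕ} (h : ℝ) (k : Fin d → Fin d → ℤ)
    (a : EuclideanSpace ℝ (Fin d)) : EuclideanSpace ℝ (Fin d) :=
  WithLp.toLp 2 fun i => ∑ j, h * k i j * a j

/-- The index of the cell of the grid of mesh `l` containing `y`. -/
noncomputable def gridCell {d : ℕ} (l : ℝ) (y : EuclideanSpace ℝ (Fin d)) : Fin d → ℤ :=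
  fun i => ⌊y i / l⌋

theorem measurable_gridCell {d : ℕ} (l : ℝ) :
    Measurable (gridCell l : EuclideanSpace ℝ (Fin d) → Fin d → ℤ) := by
  unfold gridCell
  refine measurable_pi_lambda _ fun i => Int.measurable_floor.comp ?_
  fun_prop

theorem abs_sub_lt_of_gridCell_eq {d : ℕ} {l : ℝ} (hl : 0 < l) {y z : EuclideanSpace ℝ (Fin d)}
    (h : gridCell l y = gridCell l z) (i : Fin d) : |y i - z i| < l := by
  have := Int.abs_sub_lt_one_of_floor_eq_floor (congrFun h i)
  rwa [← sub_div, abs_div, abs_of_pos hl, div_lt_one hl] at this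

theorem exists_gridMap_near {d : ℕ} {h M r : ℝ} (hh : 0 < h)
    (T : EuclideanSpace ℝ (Fin d) →ₗ[ℝ] EuclideanSpace ℝ (Fin d))
    (hT : ∀ v, ‖T v‖ ≤ M * ‖v‖) :
    ∃ k ∈ Fintype.piFinset fun _ : Fin d => Fintype.piFinset fun _ : Fin d =>
      Finset.Icc ⌊-(M / h)⌋ ⌊M / h⌋,
      ∀ a : EuclideanSpace ℝ (Fin d), ‖a‖ ≤ r → ∀ i, |T a i - gridMap h k a i| ≤ d * (h * r) := by
  set t : Fin d → Fin d → ℝ := fun i j => T (EuclideanSpace.single j 1) i with ht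
  refine ⟨fun i j => ⌊t i j / h⌋, ?_, fun a ha i => ?_⟩
  · simp only [Fintype.mem_piFinset]
    intro i j
    refine Int.floor_mem_Icc_floor_of_abs_le ?_
    rw [abs_div, abs_of_pos hh]
    gcongr
    have h1 := PiLp.norm_apply_le (T (EuclideanSpace.single j 1)) i
    have h2 := hT (EuclideanSpace.single j 1)
    simp only [PiLp.norm_single, norm_one, mul_one] at h2
    exact h1.trans h2
  · have hTa : T a i = ∑ j, t i j * a j := by
      conv_lhs => rw [EuclideanSpace.eq_sum_smul_single a]
      simp [ht, mul_comm]
    rw [hTa]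
    simp only [gridMap]
    rw [← Finset.sum_sub_distrib]
    refine (Finset.abs_sum_le_sum_abs _ _).trans ?_
    refine (Finset.sum_le_sum (g := fun _ => h * r) fun j _ => ?_).trans (by simp)
    rw [← sub_mul, abs_mul]
    have h1 : |t i j - h * ⌊t i j / h⌋| ≤ h := by
      have h2 := Int.floor_le (t i j / h)
      have h3 := Int.lt_floor_add_one (t i j / h)
      rw [le_div_iff₀ hh] at h2
      rw [div_lt_iff₀ hh] at h3
      rw [abs_le]
      constructor <;> nlinarith
    exact mul_le_mul h1 ((PiLp.norm_apply_le a j).trans ha) (abs_nonneg _) hh.le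

/-- For a finite `m`-separated set `F` in the ball of radius `r`, there is an open subset `E` of the
unit cube of nearly full measure such that few translations `z` admit a bi-Lipschitz linear
image of `F` with `T F + z ⊆ E`. -/
theorem exists_open_avoiding {d : ℕ} (hd : 1 ≤ d) {α : ℝ} (hα0 : 0 < α) (hα1 : α < 1)
    (F : Finset (EuclideanSpace ℝ (Fin d))) {m r R : ℝ} (hm : 0 < m)
    (hsep : ∀ x ∈ F, ∀ y ∈ F, x ≠ y → m ≤ ‖x - y‖) (hr : ∀ z ∈ F, ‖z‖ ≤ r)
    (hmr : m ≤ 2 * r) (hrR : r ≤ R) {q : ℝ} (hq0 : 0 ≤ q) (hq1 : q ≤ 1) :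
    ∃ E : Set (EuclideanSpace ℝ (Fin d)), IsOpen E ∧ E ⊆ unitCube d ∧
      1 ≤ volume E + ENNReal.ofReal ((6 * (R / α + 1 + R) + 6 * R) ^ d * q +
        ((8 * d ^ 2 / α ^ 2 + 4) / (m / r)) ^ (d * d) * (1 - q) ^ F.card) ∧
      volume {z | z ∈ unitCube d ∧
        ∃ T : EuclideanSpace ℝ (Fin d) →ₗ[ℝ] EuclideanSpace ℝ (Fin d),
          (∀ v, α * ‖v‖ ≤ ‖T v‖) ∧ (∀ v, ‖T v‖ ≤ α⁻¹ * ‖v‖) ∧ ∀ a ∈ F, T a + z ∈ E} ≤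
        ENNReal.ofReal ((6 * (R / α + 1 + R) + 6 * R) ^ d * q +
        ((8 * d ^ 2 / α ^ 2 + 4) / (m / r)) ^ (d * d) * (1 - q) ^ F.card) := by
  classical
  set B := (6 * (R / α + 1 + R) + 6 * R) ^ d * q +
        ((8 * d ^ 2 / α ^ 2 + 4) / (m / r)) ^ (d * d) * (1 - q) ^ F.card with hB
  have hd0 : (0 : ℝ) < d := by exact_mod_cast hd
  have hd1 : (1 : ℝ) ≤ d := by exact_mod_cast hd
  have hr0 : 0 < r := by linarith
  have hR0 : 0 < R := by linarith
  obtain ⟨l, hl⟩ : ∃ l, l = α * m / (4 * d) := ⟨_, rfl⟩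
  obtain ⟨h, hh⟩ : ∃ h, h = l / (d * r) := ⟨_, rfl⟩
  have hl0 : 0 < l := by rw [hl]; positivity
  have hh0 : 0 < h := by rw [hh]; positivity
  have hlR : l ≤ R := by
    rw [hl, div_le_iff₀ (by positivity)]
    nlinarith
  have hdhr : d * (h * r) = l := by rw [hh]; field_simp
  set D := R / α + 1 + R with hD
  have hD0 : 0 < D := by positivity
  set I : Finset (Fin d → ℤ) := Fintype.piFinset fun _ => Finset.Icc ⌊-(D / l)⌋ ⌊D / l⌋ with hI
  set K₀ : Finset (Fin d → Fin d → ℤ) := Fintype.piFinset fun _ => Fintype.piFinset fun _ =>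
    Finset.Icc ⌊-(α⁻¹ / h)⌋ ⌊α⁻¹ / h⌋ with hK₀
  set K := K₀.filter fun k => ∃ T : EuclideanSpace ℝ (Fin d) →ₗ[ℝ] EuclideanSpace ℝ (Fin d),
    (∀ v, α * ‖v‖ ≤ ‖T v‖) ∧ (∀ v, ‖T v‖ ≤ α⁻¹ * ‖v‖) ∧
      ∀ a ∈ F, ∀ i, |T a i - gridMap h k a i| ≤ l with hK
  set P : (Fin d → Fin d → ℤ) → EuclideanSpace ℝ (Fin d) → Finset (Fin d → ℤ) :=
    fun k x => F.image fun a => gridCell l (gridMap h k a + x) with hP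
  have hcube : volume (unitCube d) = 1 := by
    rw [unitCube, EuclideanSpace.volume_setOf_forall_mem_Icc (fun _ : Fin d => 0) fun _ => 1]
    simp
  have hcubemeas : MeasurableSet (unitCube d) := by
    have : unitCube d = ⋂ i, (fun y : EuclideanSpace ℝ (Fin d) => y i) ⁻¹' Set.Icc 0 1 := by
      ext y; simp [unitCube]
    rw [this]
    exact MeasurableSet.iInter fun i => measurableSet_Icc.preimage (by fun_prop)
  have hPI : ∀ k ∈ K, ∀ x ∈ unitCube d, P k x ⊆ I := by
    intro k hk x hx c hc
    obtain ⟨-, T, -, hT, hTk⟩ := Finset.mem_filter.1 hk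
    obtain ⟨a, ha, rfl⟩ := Finset.mem_image.1 hc
    refine Fintype.mem_piFinset.2 fun i => Int.floor_mem_Icc_floor_of_abs_le ?_
    rw [abs_div, abs_of_pos hl0]
    gcongr
    have h1 := hTk a ha i
    have h2 : |T a i| ≤ R / α := by
      refine (PiLp.norm_apply_le (T a) i).trans ((hT a).trans ?_)
      rw [div_eq_inv_mul]
      gcongr
      exact (hr a ha).trans hrR
    have h3 := hx i
    rw [PiLp.add_apply]
    rw [abs_le] at h1 h2 ⊢
    constructor <;> linarith [h3.1, h3.2]
  have hPN : ∀ k ∈ K, ∀ x ∈ unitCube d, (P k x).card = F.card := by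
    intro k hk x hx
    obtain ⟨-, T, hT, -, hTk⟩ := Finset.mem_filter.1 hk
    refine Finset.card_image_of_injOn fun a ha b hb hab => ?_
    by_contra hne
    have h1 : ‖T (a - b)‖ ≤ d * (3 * l) := by
      refine EuclideanSpace.norm_le_card_mul _ _ fun i => ?_
      have h2 := (abs_sub_lt_of_gridCell_eq hl0 hab i).le
      have h3 := hTk a ha i
      have h4 := hTk b hb i
      rw [map_sub, PiLp.sub_apply]
      rw [PiLp.add_apply, PiLp.add_apply] at h2
      rw [abs_le] at h2 h3 h4 ⊢
      constructor <;> linarith [h2.1, h2.2, h3.1, h3.2, h4.1, h4.2]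
    have h5 := hT (a - b)
    have h6 := mul_le_mul_of_nonneg_left (hsep a ha b hb hne) hα0.le
    have h7 : d * (3 * l) = 3 / 4 * (α * m) := by rw [hl]; field_simp
    have h8 : 0 < α * m := by positivity
    linarith
  have hmeas : ∀ k S, MeasurableSet {x | Disjoint (P k x) S} := by
    intro k S
    have : {x | Disjoint (P k x) S} =
        ⋂ a ∈ F, (fun x => gridCell l (gridMap h k a + x)) ⁻¹' {c | c ∉ S} := by
      ext x
      simp [hP, Finset.disjoint_left]
    rw [this]
    refine F.measurableSet_biInter fun a _ => ?_
    exact ((measurable_gridCell l).comp (measurable_const_add _)) (Set.to_countable _).measurableSet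
  obtain ⟨S, -, hS⟩ := exists_subset_small_avoidance volume (unitCube d) hcubemeas hcube I K P F.card
    hPI hPN hmeas q ((3 * l) ^ d) hq0 hq1
  have hIv : (I.card : ℝ) * (3 * l) ^ d ≤ (6 * D + 6 * R) ^ d := by
    rw [hI, Fintype.card_piFinset]
    simp only [Finset.prod_const, Finset.card_univ, Fintype.card_fin]
    push_cast
    rw [← mul_pow]
    gcongr
    refine (mul_le_mul_of_nonneg_right (Int.card_Icc_floor_neg_le (t := D / l) (by positivity))
      (by positivity)).trans ?_
    have : (2 * (D / l) + 2) * (3 * l) = 6 * D + 6 * l := by field_simp; ring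
    linarith
  have hKcard : (K.card : ℝ) ≤ ((8 * d ^ 2 / α ^ 2 + 4) / (m / r)) ^ (d * d) := by
    refine (Nat.cast_le.2 (Finset.card_filter_le _ _)).trans ?_
    rw [hK₀]
    simp only [Fintype.card_piFinset, Finset.prod_const, Finset.card_univ, Fintype.card_fin]
    push_cast
    rw [← pow_mul]
    gcongr
    refine (Int.card_Icc_floor_neg_le (by positivity)).trans ?_
    have h1 : 2 * (α⁻¹ / h) = 8 * d ^ 2 / α ^ 2 / (m / r) := by
      rw [hh, hl]; field_simp; ring
    have h2 : 2 ≤ 4 / (m / r) := by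
      rw [le_div_iff₀ (by positivity), ← mul_div_assoc, div_le_iff₀ hr0]
      linarith
    rw [h1, add_div]
    linarith
  have hq1' : 0 ≤ 1 - q := by linarith
  have hBS : (S.card : ℝ) * (3 * l) ^ d +
      ∑ k ∈ K, volume.real (unitCube d ∩ {x | Disjoint (P k x) S}) ≤ B := by
    refine hS.trans ?_
    rw [hB, mul_assoc, mul_comm q]
    gcongr
  set Q : (Fin d → ℤ) → Set (EuclideanSpace ℝ (Fin d)) :=
    fun c => {y | ∀ i, y i ∈ Set.Icc (l * (c i - 1)) (l * (c i + 2))} with hQ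
  have hQclosed : ∀ c, IsClosed (Q c) := fun c => by
    have : Q c = ⋂ i, (fun y : EuclideanSpace ℝ (Fin d) => y i) ⁻¹'
        Set.Icc (l * (c i - 1)) (l * (c i + 2)) := by
      ext y; simp [hQ]
    rw [this]
    exact isClosed_iInter fun i => isClosed_Icc.preimage (by fun_prop)
  have hQvol : ∀ c, volume (Q c) = ENNReal.ofReal ((3 * l) ^ d) := fun c => by
    rw [hQ, EuclideanSpace.volume_setOf_forall_mem_Icc (fun i => l * (c i - 1))
      fun i => l * (c i + 2)]
    have : ∀ i, l * ((c i : ℝ) + 2) - l * (c i - 1) = 3 * l := fun i => by ring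
    simp only [this, Finset.prod_const, Finset.card_univ, Fintype.card_fin]
    rw [ENNReal.ofReal_pow (by positivity)]
  set O : Set (EuclideanSpace ℝ (Fin d)) := {y | ∀ i, y i ∈ Set.Ioo (0 : ℝ) 1} with hO
  have hOopen : IsOpen O := by
    have : O = ⋂ i, (fun y : EuclideanSpace ℝ (Fin d) => y i) ⁻¹' Set.Ioo 0 1 := by
      ext y; simp [hO]
    rw [this]
    exact isOpen_iInter_of_finite fun i => isOpen_Ioo.preimage (by fun_prop)
  have hOvol : volume O = 1 := by
    rw [hO, EuclideanSpace.volume_setOf_forall_mem_Ioo (fun _ : Fin d => 0) fun _ => 1]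
    simp
  have hsumnn : 0 ≤ ∑ k ∈ K, volume.real (unitCube d ∩ {x | Disjoint (P k x) S}) :=
    Finset.sum_nonneg fun _ _ => measureReal_nonneg
  have hcardnn : 0 ≤ (S.card : ℝ) * (3 * l) ^ d := by positivity
  refine ⟨O \ ⋃ c ∈ S, Q c, ?_, ?_, ?_, ?_⟩
  · exact hOopen.sdiff (S.finite_toSet.isClosed_biUnion fun c _ => hQclosed c)
  · exact fun y hy i => ⟨(hy.1 i).1.le, (hy.1 i).2.le⟩
  · rw [← hOvol]
    calc volume O ≤ volume ((O \ ⋃ c ∈ S, Q c) ∪ ⋃ c ∈ S, Q c) :=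
          measure_mono (by rw [Set.sdiff_union_self]; exact Set.subset_union_left)
      _ ≤ _ := (measure_union_le _ _).trans (add_le_add_right ?_ _)
    refine (measure_biUnion_finset_le _ _).trans ?_
    simp only [hQvol, Finset.sum_const, nsmul_eq_mul]
    rw [← ENNReal.ofReal_natCast, ← ENNReal.ofReal_mul (by positivity)]
    exact ENNReal.ofReal_le_ofReal (by linarith)
  · calc _ ≤ volume (⋃ k ∈ K, unitCube d ∩ {x | Disjoint (P k x) S}) := measure_mono ?_
      _ ≤ ∑ k ∈ K, volume (unitCube d ∩ {x | Disjoint (P k x) S}) :=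
        measure_biUnion_finset_le _ _
      _ = ENNReal.ofReal (∑ k ∈ K, volume.real (unitCube d ∩ {x | Disjoint (P k x) S})) := by
        rw [ENNReal.ofReal_sum_of_nonneg fun _ _ => measureReal_nonneg]
        refine Finset.sum_congr rfl fun k _ => (ofReal_measureReal ?_).symm
        exact ((measure_mono Set.inter_subset_left).trans_lt (by simp [hcube])).ne
      _ ≤ _ := ENNReal.ofReal_le_ofReal (by linarith)
    rintro x ⟨hx, T, hT, hT', hE⟩
    obtain ⟨k, hk, hTk⟩ := exists_gridMap_near (r := r) hh0 T hT'
    replace hTk : ∀ a : EuclideanSpace ℝ (Fin d), ‖a‖ ≤ r →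
        ∀ i, |T a i - gridMap h k a i| ≤ l := fun a ha i => (hTk a ha i).trans_eq hdhr
    refine Set.mem_iUnion₂.2 ⟨k, Finset.mem_filter.2
      ⟨hk, T, hT, hT', fun a ha => hTk a (hr a ha)⟩, hx, ?_⟩
    refine Finset.disjoint_left.2 fun c hc hcS => ?_
    obtain ⟨a, ha, rfl⟩ := Finset.mem_image.1 hc
    refine (hE a ha).2 (Set.mem_iUnion₂.2 ⟨_, hcS, fun i => ?_⟩)
    have h1 := hTk a (hr a ha) i
    have h2 := Int.floor_le ((gridMap h k a + x) i / l)
    have h3 := Int.lt_floor_add_one ((gridMap h k a + x) i / l)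
    rw [le_div_iff₀ hl0] at h2
    rw [div_lt_iff₀ hl0] at h3
    rw [PiLp.add_apply] at h2 h3 ⊢
    rw [abs_le] at h1
    simp only [gridCell, PiLp.add_apply]
    constructor <;> linarith [h1.1, h1.2]

theorem exists_density_tendsto_zero (N : ℕ → ℕ) (hN : Tendsto N atTop atTop) (δ : ℕ → ℝ)
    (hδ : ∀ n, 0 < δ n) (hlog : Tendsto (fun n => -Real.log (δ n) / (N n : ℝ)) atTop (nhds 0))
    (C C₁ : ℝ) (hC₁ : 0 < C₁) (D : ℕ) :
    ∃ q : ℕ → ℝ, (∀ n, 0 ≤ q n) ∧ (∀ n, q n ≤ 1) ∧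
      Tendsto (fun n => C * q n + (C₁ / δ n) ^ D * (1 - q n) ^ N n) atTop (nhds 0) := by
  set t : ℕ → ℝ := fun n => (|Real.log (δ n)| + 1) / N n with ht
  have hNr : Tendsto (fun n => (N n : ℝ)) atTop atTop := tendsto_natCast_atTop_atTop.comp hN
  have ht0 : Tendsto t atTop (nhds 0) := by
    have h1 := hlog.abs.add hNr.inv_tendsto_atTop
    simp only [abs_zero, add_zero] at h1
    refine h1.congr fun n => ?_
    simp [ht, abs_div, add_div]
  have hs0 : Tendsto (fun n => √(t n)) atTop (nhds 0) := by
    simpa using ht0.sqrt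
  have hq : Tendsto (fun n => min 1 √(t n)) atTop (nhds 0) := by
    simpa using (tendsto_const_nhds (x := (1 : ℝ))).min hs0
  refine ⟨fun n => min 1 √(t n), fun n => le_min zero_le_one (Real.sqrt_nonneg _),
    fun n => min_le_left _ _, ?_⟩
  have hevN : ∀ᶠ n in atTop, 1 ≤ N n := hN.eventually_ge_atTop 1
  have hinv : Tendsto (fun n => (√(t n))⁻¹) atTop atTop := by
    refine Tendsto.inv_tendsto_nhdsGT_zero (tendsto_nhdsWithin_iff.2 ⟨hs0, ?_⟩)
    filter_upwards [hevN] with n hn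
    have : (0 : ℝ) < N n := by exact_mod_cast hn
    exact Real.sqrt_pos.2 (by positivity)
  set k : ℝ := D * (|Real.log C₁| + 1) with hk
  have hexp : Tendsto (fun n => Real.exp (k - (√(t n))⁻¹)) atTop (nhds 0) :=
    Real.tendsto_exp_atBot.comp (tendsto_atBot_add_const_left _ _ (tendsto_neg_atTop_atBot.comp hinv))
  have hmain : Tendsto (fun n => (C₁ / δ n) ^ D * (1 - min 1 √(t n)) ^ N n) atTop (nhds 0) := by
    refine tendsto_of_tendsto_of_tendsto_of_le_of_le' tendsto_const_nhds hexp ?_ ?_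
    · filter_upwards with n
      have : 0 ≤ 1 - min 1 √(t n) := sub_nonneg.2 (min_le_left _ _)
      have := hδ n
      positivity
    · filter_upwards [hevN, hinv.eventually_ge_atTop k, hs0.eventually_le_const zero_lt_one]
        with n hn hkn hsn
      have hNpos : (0 : ℝ) < N n := by exact_mod_cast hn
      have htpos : 0 < t n := by positivity
      have hspos : 0 < √(t n) := Real.sqrt_pos.2 htpos
      have hNt : N n * t n = |Real.log (δ n)| + 1 := by simp only [ht]; field_simp
      rw [min_eq_right hsn]
      have h1 : (C₁ / δ n) ^ D = Real.exp (D * (Real.log C₁ - Real.log (δ n))) := by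
        rw [Real.exp_nat_mul, Real.exp_sub, Real.exp_log hC₁, Real.exp_log (hδ n)]
      have h2 : (1 - √(t n)) ^ N n ≤ Real.exp (-(N n * √(t n))) := by
        rw [← mul_neg, Real.exp_nat_mul]
        exact pow_le_pow_left₀ (by linarith) (Real.one_sub_le_exp_neg _) _
      have h3 : N n * √(t n) = N n * t n * (√(t n))⁻¹ := by
        nth_rw 2 [← Real.mul_self_sqrt htpos.le]
        field_simp
      have h4 : D * (Real.log C₁ - Real.log (δ n)) ≤ N n * t n * k := by
        rw [hNt, hk]
        have h5 : Real.log C₁ - Real.log (δ n) ≤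
            (|Real.log (δ n)| + 1) * (|Real.log C₁| + 1) := by
          have := le_abs_self (Real.log C₁)
          have := neg_le_abs (Real.log (δ n))
          nlinarith [abs_nonneg (Real.log C₁), abs_nonneg (Real.log (δ n)),
            mul_nonneg (abs_nonneg (Real.log C₁)) (abs_nonneg (Real.log (δ n)))]
        calc _ ≤ (D : ℝ) * ((|Real.log (δ n)| + 1) * (|Real.log C₁| + 1)) := by gcongr
          _ = _ := by ring
      rw [h1]
      refine (mul_le_mul_of_nonneg_left h2 (Real.exp_pos _).le).trans ?_
      rw [← Real.exp_add, Real.exp_le_exp, h3]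
      have h6 : 1 ≤ N n * t n := by rw [hNt]; linarith [abs_nonneg (Real.log (δ n))]
      nlinarith
  simpa using (hq.const_mul C).add hmain

/-- `delta F` is the quotient of the separation of `F` by its maximal norm. -/
theorem exists_delta_eq_div {d : ℕ} {F : Set (EuclideanSpace ℝ (Fin d))} (hF : F.Finite)
    (hF2 : 2 ≤ F.ncard) :
    ∃ m r : ℝ, delta F = m / r ∧ 0 < m ∧ (∀ x ∈ F, ∀ y ∈ F, x ≠ y → m ≤ ‖x - y‖) ∧
      (∀ z ∈ F, ‖z‖ ≤ r) ∧ m ≤ 2 * r ∧ ∃ z ∈ F, ‖z‖ = r := by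
  set M : Set ℝ := {s : ℝ | ∃ x ∈ F, ∃ y ∈ F, x ≠ y ∧ ‖x - y‖ = s} with hM
  set Z : Set ℝ := {s : ℝ | ∃ z ∈ F, ‖z‖ = s} with hZ
  have hMfin : M.Finite := by
    refine ((hF.prod hF).image fun p => ‖p.1 - p.2‖).subset ?_
    rintro _ ⟨x, hx, y, hy, -, rfl⟩
    exact ⟨(x, y), ⟨hx, hy⟩, rfl⟩
  have hZfin : Z.Finite := hF.image _
  obtain ⟨x, y, hx, hy, hxy⟩ := (Set.one_lt_ncard_iff hF).1 hF2
  have hMmem : sInf M ∈ M := Set.Nonempty.csInf_mem ⟨_, x, hx, y, hy, hxy, rfl⟩ hMfin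
  have hZmem : sSup Z ∈ Z := Set.Nonempty.csSup_mem ⟨_, x, hx, rfl⟩ hZfin
  have hsep : ∀ x ∈ F, ∀ y ∈ F, x ≠ y → sInf M ≤ ‖x - y‖ := fun x hx y hy hxy =>
    csInf_le hMfin.bddBelow ⟨x, hx, y, hy, hxy, rfl⟩
  have hle : ∀ z ∈ F, ‖z‖ ≤ sSup Z := fun z hz => le_csSup hZfin.bddAbove ⟨z, hz, rfl⟩
  refine ⟨sInf M, sSup Z, rfl, ?_, hsep, hle, ?_, hZmem⟩
  · obtain ⟨u, -, v, -, huv, h⟩ := hMmem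
    rw [← h]
    exact norm_pos_iff.2 (sub_ne_zero.2 huv)
  · linarith [hsep x hx y hy hxy, norm_sub_le x y, hle x hx, hle y hy]

theorem memS.bounds {d : ℕ} {α β : ℝ}
    {T : EuclideanSpace ℝ (Fin d) ≃ₗ[ℝ] EuclideanSpace ℝ (Fin d)} (hT : memS α β T)
    (v : EuclideanSpace ℝ (Fin d)) : α * ‖v‖ ≤ ‖T v‖ ∧ ‖T v‖ ≤ β * ‖v‖ := by
  rcases eq_or_ne v 0 with rfl | hv
  · simp
  have hv0 : 0 < ‖v‖ := norm_pos_iff.2 hv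
  have hu : ‖(‖v‖⁻¹ • v)‖ = 1 := by rw [norm_smul, norm_inv, norm_norm, inv_mul_cancel₀ hv0.ne']
  have hTu : ‖T (‖v‖⁻¹ • v)‖ = ‖T v‖ / ‖v‖ := by
    rw [map_smul, norm_smul, norm_inv, norm_norm, div_eq_inv_mul]
  rw [← le_div_iff₀ hv0, ← div_le_iff₀ hv0, ← hTu]
  constructor
  · refine hT.1.le.trans (csInf_le ⟨0, ?_⟩ ⟨_, hu, rfl⟩)
    rintro _ ⟨u, -, rfl⟩
    exact norm_nonneg _
  · refine (le_csSup (s := {s : ℝ | ∃ u : EuclideanSpace ℝ (Fin d), ‖u‖ = 1 ∧ ‖T u‖ = s})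
      ⟨‖LinearMap.toContinuousLinearMap T.toLinearMap‖, ?_⟩ ⟨_, hu, rfl⟩).trans hT.2.le
    rintro _ ⟨u, hu, rfl⟩
    simpa [hu] using (LinearMap.toContinuousLinearMap T.toLinearMap).le_opNorm u

/-- **Key proposition.** Under the hypotheses of the generalized Kolountzakis theorem,
for every `0 < α < 1` there are open sets `E_n ⊆ [0,1]^d` with `μ(E_n) → 1` and
`μ*(V_n) → 0`, where `V_n` is the set of `x ∈ [0,1]^d` for which some
`T ∈ S_α^{1/α}` satisfies `T A + x ⊆ E_n`. -/
theorem stmt7 (d : ℕ) (hd : 1 ≤ d) (A : Set (EuclideanSpace ℝ (Fin d)))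
    (hbdd : Bornology.IsBounded A) (hinf : A.Infinite)
    (An : ℕ → Set (EuclideanSpace ℝ (Fin d)))
    (hfin : ∀ n, (An n).Finite) (hsub : ∀ n, An n ⊆ A \ {0})
    (hcard2 : ∀ n, 2 ≤ (An n).ncard)
    (hcard : Tendsto (fun n => (An n).ncard) atTop atTop)
    (hlog : Tendsto (fun n => -Real.log (delta (An n)) / ((An n).ncard : ℝ))
      atTop (nhds 0))
    (α : ℝ) (hα0 : 0 < α) (hα1 : α < 1) :
    ∃ E : ℕ → Set (EuclideanSpace ℝ (Fin d)),
      (∀ n, IsOpen (E n)) ∧ (∀ n, E n ⊆ unitCube d) ∧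
      Tendsto (fun n => volume (E n)) atTop (nhds 1) ∧
      Tendsto (fun n => volume {z : EuclideanSpace ℝ (Fin d) | z ∈ unitCube d ∧
          ∃ T : EuclideanSpace ℝ (Fin d) ≃ₗ[ℝ] EuclideanSpace ℝ (Fin d),
            memS α (1 / α) T ∧ (fun a => T a + z) '' A ⊆ E n})
        atTop (nhds 0) := by
  obtain ⟨R, hR⟩ := isBounded_iff_forall_norm_le.1 hbdd
  choose m r hδ hm hsep hr hmr hmax using fun n => exists_delta_eq_div (hfin n) (hcard2 n)
  have hr0 : ∀ n, 0 < r n := fun n => by linarith [hm n, hmr n]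
  have hrR : ∀ n, r n ≤ R := fun n => by
    obtain ⟨z, hz, hzr⟩ := hmax n
    exact hzr ▸ hR z (hsub n hz).1
  obtain ⟨q, hq0, hq1, hB⟩ := exists_density_tendsto_zero (fun n => (An n).ncard) hcard
    (fun n => delta (An n)) (fun n => by rw [hδ n]; exact div_pos (hm n) (hr0 n)) hlog
    ((6 * (R / α + 1 + R) + 6 * R) ^ d) (8 * d ^ 2 / α ^ 2 + 4) (by positivity) (d * d)
  have hcore := fun n => exists_open_avoiding hd hα0 hα1 (hfin n).toFinset (hm n)
    (by simpa using hsep n) (by simpa using hr n) (hmr n) (hrR n) (hq0 n) (hq1 n)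
  choose E hEopen hEcube hEvol hEavoid using hcore
  have hB' := ENNReal.tendsto_ofReal hB
  rw [ENNReal.ofReal_zero] at hB'
  simp only [← Set.ncard_eq_toFinset_card _ (hfin _), ← hδ] at hEvol hEavoid
  have hcube : volume (unitCube d) = 1 := by
    rw [unitCube, EuclideanSpace.volume_setOf_forall_mem_Icc (fun _ : Fin d => 0) fun _ => 1]
    simp
  refine ⟨E, hEopen, hEcube, ?_, ?_⟩
  · refine tendsto_of_tendsto_of_tendsto_of_le_of_le ?_ tendsto_const_nhds
      (fun n => tsub_le_iff_right.2 (hEvol n))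
      (fun n => (measure_mono (hEcube n)).trans_eq hcube)
    simpa using ENNReal.Tendsto.sub tendsto_const_nhds hB' (Or.inl ENNReal.one_ne_top)
  · refine tendsto_of_tendsto_of_tendsto_of_le_of_le tendsto_const_nhds hB' (fun _ => zero_le)
      fun n => (measure_mono ?_).trans (hEavoid n)
    rintro z ⟨hz, T, hT, hTE⟩
    refine ⟨hz, T, fun v => (hT.bounds v).1, fun v => ?_, fun a ha => hTE ⟨a, ?_, rfl⟩⟩
    · simpa using (hT.bounds v).2
    · exact (hsub n (by simpa using ha)).1
end

section
/- Let d ≥ 1 and let A ⊆ ℝ^d be a bounded infinite set with 0 ∈ A. Suppose there exists a sequence {A_n}_{n=1}^∞ of finite subsets of A ∖ {0}, each with at least two elements, such that #A_n → ∞ and (−log δ(A_n))/#A_n → 0. Then for every α with 0 < α < 1 there exists a closed set E_α ⊆ [0,1]^d with μ(E_α) > 1 − α such that TA + x ⊄ E_α for every T ∈ S_α^{1/α} and every x ∈ ℝ^d. -/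
open MeasureTheory Filter Set

/-- The proportion of colourings with `q` colours that avoid the colour `0` on `f`. -/
theorem card_colorings_avoiding {V : Type*} [Fintype V] [DecidableEq V] (q : ℕ) [NeZero q]
    (f : Finset V) :
    ((Finset.univ.filter fun c : V → Fin q => ∀ v ∈ f, c v ≠ 0).card : ℝ) =
      (q : ℝ) ^ Fintype.card V * (1 - 1 / (q : ℝ)) ^ f.card := by
  have hq : (q : ℝ) ≠ 0 := Nat.cast_ne_zero.mpr (NeZero.ne q)
  have hset : (Finset.univ.filter fun c : V → Fin q => ∀ v ∈ f, c v ≠ 0) =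
      Fintype.piFinset fun v => if v ∈ f then Finset.univ.erase (0 : Fin q) else Finset.univ := by
    ext c
    simp only [Finset.mem_filter, Finset.mem_univ, true_and, Fintype.mem_piFinset]
    refine forall_congr' fun v => ?_
    by_cases hv : v ∈ f <;> simp [hv]
  have hterm : ∀ v : V,
      (((if v ∈ f then Finset.univ.erase (0 : Fin q) else Finset.univ).card : ℕ) : ℝ) =
        (q : ℝ) * if v ∈ f then 1 - 1 / (q : ℝ) else 1 := by
    intro v
    by_cases hv : v ∈ f
    · simp only [hv, if_true, Finset.card_erase_of_mem (Finset.mem_univ _), Finset.card_univ,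
        Fintype.card_fin]
      rw [Nat.cast_sub (Nat.one_le_iff_ne_zero.mpr (NeZero.ne q))]
      field_simp
      simp
    · simp [hv]
  rw [hset, Fintype.card_piFinset, Nat.cast_prod, Finset.prod_congr rfl fun v _ => hterm v,
    Finset.prod_mul_distrib, Finset.prod_const, Finset.card_univ, Finset.prod_ite_mem]
  simp

/-- A sparse set meeting every large member of a small family of finite sets. -/
theorem exists_sparse_hitting_set {V ι ζ : Type*} [Fintype V] [DecidableEq V] [Fintype ι]
    (q N : ℕ) (hq : 1 ≤ q) (f : ι → Finset V) (Z : Finset ζ) (hZ : Z.Nonempty) (π : ζ → V)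
    (h : (Fintype.card ι : ℝ) * (1 - 1 / (q : ℝ)) ^ N < 1 / 2) :
    ∃ R : Finset V, ((Z.filter fun z => π z ∈ R).card : ℝ) ≤ 2 / q * Z.card ∧
      ∀ i, N ≤ (f i).card → ∃ v ∈ f i, v ∈ R := by
  classical
  have : NeZero q := ⟨by omega⟩
  have hq0 : (0 : ℝ) < q := by exact_mod_cast hq
  have hq1 : (1 : ℝ) / q ≤ 1 := by rw [div_le_one hq0]; exact_mod_cast hq
  have hr0 : (0 : ℝ) ≤ 1 - 1 / q := by linarith
  have hr1 : 1 - 1 / (q : ℝ) ≤ 1 := by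
    have : (0 : ℝ) ≤ 1 / q := by positivity
    linarith
  have hZc : (0 : ℝ) < Z.card := by exact_mod_cast hZ.card_pos
  set Q : ℝ := (q : ℝ) ^ Fintype.card V with hQ
  have hQ0 : 0 < Q := by positivity
  let I : Finset ι := Finset.univ.filter fun i => N ≤ (f i).card
  let a : (V → Fin q) → ℝ := fun c => ((Z.filter fun z => c (π z) = 0).card : ℝ)
  let b : (V → Fin q) → ℝ := fun c => ((I.filter fun i => ∀ v ∈ f i, c v ≠ 0).card : ℝ)
  have hcolor : ∀ v : V,
      ((Finset.univ.filter fun c : V → Fin q => c v = 0).card : ℝ) = Q / q := by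
    intro v
    have h1 := card_colorings_avoiding q ({v} : Finset V)
    have h2 := Finset.card_filter_add_card_filter_not (s := (Finset.univ : Finset (V → Fin q)))
      (fun c => c v = 0)
    have h3 : ((Finset.univ : Finset (V → Fin q)).card : ℝ) = Q := by simp [hQ]
    rw [← h2] at h3
    push_cast at h3
    simp only [Finset.mem_singleton, forall_eq, Finset.card_singleton, pow_one] at h1
    have h4 : ((Finset.univ.filter fun c : V → Fin q => ¬ c v = 0).card : ℝ) =
      Q * (1 - 1 / q) := h1
    rw [h4] at h3
    have : Q * (1 - 1 / q) = Q - Q / q := by ring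
    linarith
  have ha : ∑ c, a c = Z.card * (Q / q) := by
    simp only [a, Finset.card_filter, Nat.cast_sum]
    rw [Finset.sum_comm]
    simp only [← Nat.cast_sum, ← Finset.card_filter, hcolor]
    simp
  have hb : ∑ c, b c ≤ Fintype.card ι * (Q * (1 - 1 / q) ^ N) := by
    simp only [b, Finset.card_filter, Nat.cast_sum]
    rw [Finset.sum_comm]
    simp only [← Nat.cast_sum, ← Finset.card_filter, card_colorings_avoiding]
    calc ∑ i ∈ I, Q * (1 - 1 / (q : ℝ)) ^ (f i).card
        ≤ ∑ _i ∈ I, Q * (1 - 1 / (q : ℝ)) ^ N := by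
          refine Finset.sum_le_sum fun i hi => ?_
          have hi' : N ≤ (f i).card := (Finset.mem_filter.mp hi).2
          exact mul_le_mul_of_nonneg_left (pow_le_pow_of_le_one hr0 hr1 hi') hQ0.le
      _ = I.card * (Q * (1 - 1 / q) ^ N) := by simp
      _ ≤ _ := by
          refine mul_le_mul_of_nonneg_right ?_ (by positivity)
          exact_mod_cast Finset.card_le_univ I
  have hsum : ∑ c, (a c * q + 2 * Z.card * b c) < ∑ _c : V → Fin q, 2 * (Z.card : ℝ) := by
    rw [Finset.sum_add_distrib, ← Finset.sum_mul, ← Finset.mul_sum, ha]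
    have : ∑ _c : V → Fin q, 2 * (Z.card : ℝ) = Q * (2 * Z.card) := by simp [hQ]
    rw [this]
    have h5 : (Z.card : ℝ) * (Q / q) * q = Z.card * Q := by field_simp
    rw [h5]
    have h6 : ∑ c, b c < Q / 2 := by
      refine hb.trans_lt ?_
      have := mul_lt_mul_of_pos_left h hQ0
      linarith
    have := mul_lt_mul_of_pos_left h6 (by positivity : 0 < 2 * (Z.card : ℝ))
    linarith
  obtain ⟨c, -, hc⟩ := Finset.exists_lt_of_sum_lt hsum
  refine ⟨Finset.univ.filter fun v => c v = 0, ?_, ?_⟩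
  · have hb0 : 0 ≤ 2 * (Z.card : ℝ) * b c := by positivity
    have : a c ≤ 2 / q * Z.card := by
      rw [div_mul_eq_mul_div, le_div_iff₀ hq0]
      linarith
    simpa [a] using this
  · intro i hi
    by_contra! hcon
    have h7 : 1 ≤ b c := by
      have : i ∈ I.filter fun i => ∀ v ∈ f i, c v ≠ 0 := by
        simp only [Finset.mem_filter, Finset.mem_univ, true_and, I]
        exact ⟨hi, fun v hv => by simpa using hcon v hv⟩
      exact Nat.one_le_cast.mpr (Finset.card_pos.mpr ⟨i, this⟩)
    have ha0 : 0 ≤ a c * q := by positivity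
    nlinarith

theorem norm_apply_bounds {d : ℕ} {α β : ℝ}
    {T : EuclideanSpace ℝ (Fin d) →ₗ[ℝ] EuclideanSpace ℝ (Fin d)} (hmin : α < opMin T)
    (hmax : opMax T < β) (u : EuclideanSpace ℝ (Fin d)) :
    α * ‖u‖ ≤ ‖T u‖ ∧ ‖T u‖ ≤ β * ‖u‖ := by
  rcases eq_or_ne u 0 with rfl | hu
  · simp
  have hu' : 0 < ‖u‖ := norm_pos_iff.mpr hu
  have hmem : ‖u‖⁻¹ * ‖T u‖ ∈
      {s : ℝ | ∃ u : EuclideanSpace ℝ (Fin d), ‖u‖ = 1 ∧ ‖T u‖ = s} := by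
    refine ⟨‖u‖⁻¹ • u, ?_, ?_⟩
    · rw [norm_smul, norm_inv, norm_norm, inv_mul_cancel₀ hu'.ne']
    · rw [map_smul, norm_smul, norm_inv, norm_norm]
  have h1 := hmin.le.trans (csInf_le ⟨0, by rintro _ ⟨w, -, rfl⟩; positivity⟩ hmem)
  have h2 := (le_csSup ⟨‖LinearMap.toContinuousLinearMap T‖, by
    rintro _ ⟨w, hw, rfl⟩
    simpa [hw] using (LinearMap.toContinuousLinearMap T).le_opNorm w⟩ hmem).trans hmax.le
  rw [inv_mul_eq_div] at h1 h2
  exact ⟨(le_div_iff₀ hu').mp h1, (div_le_iff₀ hu').mp h2⟩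

theorem exists_separation_radius {d : ℕ} {F : Set (EuclideanSpace ℝ (Fin d))} (hF : F.Finite)
    (h2 : 2 ≤ F.ncard) :
    ∃ σ M : ℝ, 0 < σ ∧ 0 < M ∧ σ ≤ 2 * M ∧ delta F = σ / M ∧
      (∀ x ∈ F, ∀ y ∈ F, x ≠ y → σ ≤ ‖x - y‖) ∧ (∀ z ∈ F, ‖z‖ ≤ M) ∧ ∃ z ∈ F, ‖z‖ = M := by
  obtain ⟨x, hx, y, hy, hxy⟩ := (Set.one_lt_ncard hF).mp h2
  set D := {s : ℝ | ∃ x ∈ F, ∃ y ∈ F, x ≠ y ∧ ‖x - y‖ = s} with hD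
  set B := {s : ℝ | ∃ z ∈ F, ‖z‖ = s} with hB
  have hDfin : D.Finite := by
    refine ((hF.prod hF).image fun p => ‖p.1 - p.2‖).subset ?_
    rintro _ ⟨a, ha, b, hb, -, rfl⟩
    exact ⟨(a, b), ⟨ha, hb⟩, rfl⟩
  have hBfin : B.Finite := hF.image fun z => ‖z‖
  have hDne : D.Nonempty := ⟨_, x, hx, y, hy, hxy, rfl⟩
  have hBne : B.Nonempty := ⟨_, x, hx, rfl⟩
  have hσ : sInf D ∈ D := hDne.csInf_mem hDfin
  have hM : sSup B ∈ B := hBne.csSup_mem hBfin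
  have hlow : ∀ x ∈ F, ∀ y ∈ F, x ≠ y → sInf D ≤ ‖x - y‖ := fun a ha b hb hab =>
    csInf_le hDfin.bddBelow ⟨a, ha, b, hb, hab, rfl⟩
  have hup : ∀ z ∈ F, ‖z‖ ≤ sSup B := fun z hz => le_csSup hBfin.bddAbove ⟨z, hz, rfl⟩
  have hσ0 : 0 < sInf D := by
    obtain ⟨a, -, b, -, hab, h⟩ := hσ
    rw [← h]
    exact norm_pos_iff.mpr (sub_ne_zero.mpr hab)
  have hle : sInf D ≤ 2 * sSup B := by
    have := (hlow x hx y hy hxy).trans (norm_sub_le x y)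
    linarith [hup x hx, hup y hy]
  exact ⟨sInf D, sSup B, hσ0, by linarith, hle, rfl, hlow, hup, hM⟩

theorem eventually_pow_mul_pow_lt_half {δ : ℕ → ℝ} {N : ℕ → ℕ} (hδ : ∀ n, 0 < δ n)
    (hN : Tendsto N atTop atTop)
    (hlog : Tendsto (fun n => -Real.log (δ n) / (N n : ℝ)) atTop (nhds 0))
    {C ρ : ℝ} (hC : 0 < C) (hρ0 : 0 < ρ) (hρ1 : ρ < 1) (e : ℕ) :
    ∀ᶠ n in atTop, (C / δ n) ^ e * ρ ^ N n < 1 / 2 := by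
  have hN' : Tendsto (fun n => (N n : ℝ)) atTop atTop := tendsto_natCast_atTop_atTop.comp hN
  have hlim : Tendsto (fun n => (e * Real.log C + Real.log 2) / (N n : ℝ) +
      e * (-Real.log (δ n) / (N n : ℝ)) + Real.log ρ) atTop (nhds (0 + e * 0 + Real.log ρ)) :=
    ((hN'.const_div_atTop _).add (hlog.const_mul _)).add_const _
  rw [mul_zero, add_zero, zero_add] at hlim
  filter_upwards [hlim.eventually_lt_const (Real.log_neg hρ0 hρ1),
    hN'.eventually_gt_atTop 0] with n hn hn0
  have h1 : 0 < C / δ n := div_pos hC (hδ n)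
  rw [← Real.log_lt_log_iff (by positivity) (by norm_num), Real.log_mul (by positivity)
    (by positivity), Real.log_pow, Real.log_pow, Real.log_div hC.ne' (hδ n).ne', one_div,
    Real.log_inv]
  have h2 := mul_neg_of_neg_of_pos hn hn0
  have h3 : ((e * Real.log C + Real.log 2) / (N n : ℝ) +
      e * (-Real.log (δ n) / (N n : ℝ)) + Real.log ρ) * N n =
      e * Real.log C + Real.log 2 - e * Real.log (δ n) + N n * Real.log ρ := by
    field_simp
    ring
  rw [h3] at h2
  linarith

theorem EuclideanSpace.abs_apply_le_norm {d : ℕ} (y : EuclideanSpace ℝ (Fin d)) (i : Fin d) :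
    |y i| ≤ ‖y‖ := PiLp.norm_apply_le y i

theorem EuclideanSpace.eq_sum_single {d : ℕ} (y : EuclideanSpace ℝ (Fin d)) :
    y = ∑ j, y j • EuclideanSpace.single j (1 : ℝ) := by
  simpa using ((EuclideanSpace.basisFun (Fin d) ℝ).sum_repr y).symm

theorem EuclideanSpace.norm_le_sum_abs {d : ℕ} (y : EuclideanSpace ℝ (Fin d)) :
    ‖y‖ ≤ ∑ i, |y i| := by
  conv_lhs => rw [EuclideanSpace.eq_sum_single y]
  refine (norm_sum_le _ _).trans (Finset.sum_le_sum fun j _ => ?_)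
  simp [norm_smul]

theorem EuclideanSpace.linearMap_apply_eq_sum {d : ℕ}
    (T : EuclideanSpace ℝ (Fin d) →ₗ[ℝ] EuclideanSpace ℝ (Fin d))
    (y : EuclideanSpace ℝ (Fin d)) (i : Fin d) :
    T y i = ∑ j, T (EuclideanSpace.single j 1) i * y j := by
  conv_lhs => rw [EuclideanSpace.eq_sum_single y]
  simp [map_sum, mul_comm]

theorem EuclideanSpace.volume_box {d : ℕ} (a b : Fin d → ℝ) :
    volume {y : EuclideanSpace ℝ (Fin d) | ∀ i, y i ∈ Ioo (a i) (b i)} =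
      ∏ i, ENNReal.ofReal (b i - a i) := by
  rw [← Real.volume_pi_Ioo,
    ← (PiLp.volume_preserving_ofLp (Fin d)).measure_preimage
      (MeasurableSet.univ_pi fun i => measurableSet_Ioo).nullMeasurableSet]
  congr 1
  ext y
  simp [Set.mem_pi]

theorem volume_unitCube (d : ℕ) : volume (unitCube d) = 1 := by
  have h : unitCube d = (WithLp.ofLp : EuclideanSpace ℝ (Fin d) → Fin d → ℝ) ⁻¹'
      (Icc (fun _ => 0) fun _ => 1) := by
    ext y
    simp [unitCube, Pi.le_def, forall_and]
  rw [h, (PiLp.volume_preserving_ofLp (Fin d)).measure_preimage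
      measurableSet_Icc.nullMeasurableSet, Real.volume_Icc_pi]
  simp

theorem isClosed_unitCube (d : ℕ) : IsClosed (unitCube d) := by
  have : unitCube d = ⋂ i, {y : EuclideanSpace ℝ (Fin d) | y i ∈ Icc (0 : ℝ) 1} := by
    ext y
    simp [unitCube]
  rw [this]
  exact isClosed_iInter fun i => isClosed_Icc.preimage (by fun_prop)

/-- The open cube of side `5 * s` surrounding the cell of the lattice `s ℤ^d` with index `z`. -/
def enlargedCell {d : ℕ} (s : ℝ) (z : Fin d → ℤ) : Set (EuclideanSpace ℝ (Fin d)) :=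
  {y | ∀ i, y i ∈ Ioo (s * (z i - 2)) (s * (z i + 3))}

theorem isOpen_enlargedCell {d : ℕ} (s : ℝ) (z : Fin d → ℤ) : IsOpen (enlargedCell s z) := by
  have : enlargedCell s z =
      ⋂ i, {y : EuclideanSpace ℝ (Fin d) | y i ∈ Ioo (s * (z i - 2)) (s * (z i + 3))} := by
    ext y
    simp [enlargedCell]
  rw [this]
  exact isOpen_iInter_of_finite fun i => isOpen_Ioo.preimage (by fun_prop)

theorem volume_enlargedCell {d : ℕ} (s : ℝ) (z : Fin d → ℤ) :
    volume (enlargedCell s z) = ENNReal.ofReal (5 * s) ^ d := by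
  rw [enlargedCell, EuclideanSpace.volume_box]
  have h (i : Fin d) : s * ((z i : ℝ) + 3) - s * (z i - 2) = 5 * s := by ring
  simp [h]

/-- The indices of the lattice cells whose enlargement can meet the unit cube. -/
noncomputable def cubeCells (d : ℕ) (s : ℝ) : Finset (Fin d → ℤ) :=
  Fintype.piFinset fun _ => Finset.Icc (-3) (⌊1 / s⌋ + 2)

theorem mem_cubeCells {d : ℕ} {s : ℝ} (hs : 0 < s) {z : Fin d → ℤ}
    {y : EuclideanSpace ℝ (Fin d)} (hy : y ∈ unitCube d) (hyz : y ∈ enlargedCell s z) :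
    z ∈ cubeCells d s := by
  simp only [cubeCells, Fintype.mem_piFinset, Finset.mem_Icc]
  intro i
  obtain ⟨h0, h1⟩ := hy i
  obtain ⟨h2, h3⟩ := hyz i
  constructor
  · have : (-3 : ℝ) < z i := by nlinarith
    exact_mod_cast this.le
  · rw [← sub_le_iff_le_add, Int.le_floor, le_div_iff₀ hs]
    push_cast
    nlinarith

theorem cubeCells_nonempty {d : ℕ} {s : ℝ} (hs : 0 < s) : (cubeCells d s).Nonempty := by
  refine ⟨0, ?_⟩
  simp only [cubeCells, Fintype.mem_piFinset, Finset.mem_Icc]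
  intro i
  have : (0 : ℤ) ≤ ⌊1 / s⌋ := Int.floor_nonneg.mpr (by positivity)
  simp only [Pi.zero_apply]
  omega

theorem card_cubeCells_mul_le {d : ℕ} {s : ℝ} (hs : 0 < s) (hs1 : s ≤ 1) :
    ((cubeCells d s).card : ℝ) * (5 * s) ^ d ≤ 35 ^ d := by
  have h0 : (0 : ℤ) ≤ ⌊1 / s⌋ := Int.floor_nonneg.mpr (by positivity)
  have hc : ((cubeCells d s).card : ℝ) = ((⌊1 / s⌋ : ℝ) + 6) ^ d := by
    rw [cubeCells, Fintype.card_piFinset]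
    simp only [Int.card_Icc, Finset.prod_const, Finset.card_univ, Fintype.card_fin, Nat.cast_pow]
    congr 1
    have h : ((⌊1 / s⌋ + 2 + 1 - -3).toNat : ℤ) = ⌊1 / s⌋ + 6 := by omega
    have h' : (((⌊1 / s⌋ + 2 + 1 - -3).toNat : ℤ) : ℝ) = ((⌊1 / s⌋ + 6 : ℤ) : ℝ) := by rw [h]
    rw [Int.cast_natCast] at h'
    rw [h']
    push_cast
    rfl
  rw [hc, ← mul_pow]
  have h0' : (0 : ℝ) ≤ ⌊1 / s⌋ := by exact_mod_cast h0
  refine pow_le_pow_left₀ (by positivity) ?_ d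
  have h1 := (le_div_iff₀ hs).mp (Int.floor_le (1 / s))
  nlinarith

theorem lt_volume_unitCube_diff {d : ℕ} {s α : ℝ} (hs : 0 < s) (hs1 : s ≤ 1)
    (hα1 : α < 1) (W : Finset (Fin d → ℤ)) {r : ℝ}
    (hW : (W.card : ℝ) ≤ r * (cubeCells d s).card) (hr0 : 0 ≤ r) (hr : r * 35 ^ d < α) :
    ENNReal.ofReal (1 - α) < volume (unitCube d \ ⋃ z ∈ W, enlargedCell s z) := by
  have hvol : volume (⋃ z ∈ W, enlargedCell s z) ≤ ENNReal.ofReal (r * 35 ^ d) := by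
    calc volume (⋃ z ∈ W, enlargedCell s z) ≤ ∑ z ∈ W, volume (enlargedCell s z) :=
          measure_biUnion_finset_le _ _
      _ = ENNReal.ofReal (W.card * (5 * s) ^ d) := by
          simp only [volume_enlargedCell, Finset.sum_const, nsmul_eq_mul]
          rw [ENNReal.ofReal_mul (Nat.cast_nonneg _), ENNReal.ofReal_natCast,
            ENNReal.ofReal_pow (by positivity)]
      _ ≤ _ := by
          refine ENNReal.ofReal_le_ofReal ?_
          calc (W.card : ℝ) * (5 * s) ^ d ≤ r * (cubeCells d s).card * (5 * s) ^ d := by gcongr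
            _ = r * ((cubeCells d s).card * (5 * s) ^ d) := by ring
            _ ≤ _ := mul_le_mul_of_nonneg_left (card_cubeCells_mul_le hs hs1) hr0
  refine lt_of_lt_of_le ?_ le_measure_sdiff
  rw [volume_unitCube]
  refine lt_of_lt_of_le ?_ (tsub_le_tsub_left hvol 1)
  rw [← ENNReal.ofReal_one, ← ENNReal.ofReal_sub _ (by positivity)]
  exact (ENNReal.ofReal_lt_ofReal_iff (by linarith)).mpr (by linarith)

/-- The lattice cell that contains the image of `a` under the matrix `η k`. -/
noncomputable def cellIndex {d : ℕ} (s η : ℝ) (k : Fin d → Fin d → ℤ)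
    (a : EuclideanSpace ℝ (Fin d)) (i : Fin d) : ℤ :=
  ⌊(∑ j, k i j * η * a j) / s⌋

theorem abs_apply_sub_discretized_le {d : ℕ} {η M : ℝ} (hη : 0 < η)
    (T : EuclideanSpace ℝ (Fin d) →ₗ[ℝ] EuclideanSpace ℝ (Fin d))
    (a : EuclideanSpace ℝ (Fin d)) (ha : ‖a‖ ≤ M) (i : Fin d) :
    |T a i - ∑ j, (⌊T (EuclideanSpace.single j 1) i / η⌋ : ℝ) * η * a j| ≤ d * (η * M) := by
  rw [EuclideanSpace.linearMap_apply_eq_sum, ← Finset.sum_sub_distrib]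
  refine (Finset.abs_sum_le_sum_abs _ _).trans ?_
  calc _ ≤ ∑ _j : Fin d, η * M := Finset.sum_le_sum fun j _ => ?_
    _ = _ := by simp
  rw [← sub_mul, abs_mul]
  refine mul_le_mul ?_ ((EuclideanSpace.abs_apply_le_norm a j).trans ha) (abs_nonneg _) hη.le
  have h1 := (le_div_iff₀ hη).mp (Int.floor_le (T (EuclideanSpace.single j 1) i / η))
  have h2 := (div_lt_iff₀ hη).mp (Int.lt_floor_add_one (T (EuclideanSpace.single j 1) i / η))
  rw [abs_le]
  constructor <;> nlinarith

/-- Well-separated points land in cells that are distinct modulo `m`. -/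
theorem cellIndex_mod_injOn {d : ℕ} {s η α σ M : ℝ} (hs : 0 < s) (hη : 0 < η) (hα : 0 < α)
    (hηM : d * (η * M) ≤ s) (hsσ : d * (3 * s) < α * σ) {m : ℕ}
    (hm : 2 * M / (α * s) + 3 ≤ m) (F : Finset (EuclideanSpace ℝ (Fin d)))
    (hsep : ∀ x ∈ F, ∀ y ∈ F, x ≠ y → σ ≤ ‖x - y‖) (hM : ∀ z ∈ F, ‖z‖ ≤ M)
    (T : EuclideanSpace ℝ (Fin d) →ₗ[ℝ] EuclideanSpace ℝ (Fin d))
    (hlow : ∀ u, α * ‖u‖ ≤ ‖T u‖) (hup : ∀ u, ‖T u‖ ≤ 1 / α * ‖u‖) (t : Fin d → ZMod m) :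
    Set.InjOn (fun a i => (cellIndex s η (fun i j => ⌊T (EuclideanSpace.single j 1) i / η⌋) a i :
      ZMod m) + t i) F := by
  intro a ha b hb hab
  set k : Fin d → Fin d → ℤ := fun i j => ⌊T (EuclideanSpace.single j 1) i / η⌋ with hk
  have herr : ∀ c ∈ F, ∀ i, T c i / s - cellIndex s η k c i ∈ Ico (-1 : ℝ) 2 := by
    intro c hc i
    have h1 := abs_le.mp ((abs_apply_sub_discretized_le hη T c (hM c hc) i).trans hηM)
    set S := ∑ j, (k i j : ℝ) * η * c j with hS
    have h2 := Int.floor_le (S / s)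
    have h3 := Int.lt_floor_add_one (S / s)
    have h4 : T c i / s - S / s = (T c i - S) / s := by ring
    have h5 : (-1 : ℝ) ≤ (T c i - S) / s := by rw [le_div_iff₀ hs]; linarith [h1.1]
    have h6 : (T c i - S) / s ≤ 1 := by rw [div_le_one hs]; exact h1.2
    change T c i / s - (⌊S / s⌋ : ℝ) ∈ _
    constructor <;> linarith
  have hdiff : ∀ i, |(T (a - b) i) / s - ((cellIndex s η k a i : ℝ) - cellIndex s η k b i)| < 3 := by
    intro i
    obtain ⟨h1, h2⟩ := herr a ha i
    obtain ⟨h3, h4⟩ := herr b hb i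
    rw [map_sub, PiLp.sub_apply, sub_div, abs_lt]
    constructor <;> linarith
  have hcell : ∀ i, cellIndex s η k a i = cellIndex s η k b i := by
    intro i
    have h1 : ((cellIndex s η k a i : ℤ) : ZMod m) = (cellIndex s η k b i : ℤ) :=
      add_right_cancel (congrFun hab i)
    have h2 : (m : ℤ) ∣ cellIndex s η k a i - cellIndex s η k b i :=
      (ZMod.intCast_eq_intCast_iff_dvd_sub _ _ _).mp h1.symm
    have h3 : |(T (a - b) i) / s| ≤ 2 * M / (α * s) := by
      have h4 : ‖a - b‖ ≤ 2 * M := by linarith [norm_sub_le a b, hM a ha, hM b hb]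
      calc |(T (a - b) i) / s| = |T (a - b) i| / s := by rw [abs_div, abs_of_pos hs]
        _ ≤ (1 / α * (2 * M)) / s := by
            refine div_le_div_of_nonneg_right ?_ hs.le
            refine (EuclideanSpace.abs_apply_le_norm _ i).trans ((hup _).trans ?_)
            gcongr
        _ = _ := by field_simp
    have h5 : |((cellIndex s η k a i - cellIndex s η k b i : ℤ) : ℝ)| < m := by
      have h6 := abs_lt.mp (hdiff i)
      have h7 := abs_le.mp h3
      push_cast
      rw [abs_lt]
      constructor <;> linarith
    exact sub_eq_zero.mp (Int.eq_zero_of_abs_lt_dvd h2 (by exact_mod_cast h5))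
  by_contra hne
  have h1 : ‖T (a - b)‖ ≤ d * (3 * s) := by
    refine (EuclideanSpace.norm_le_sum_abs _).trans ?_
    calc _ ≤ ∑ _i : Fin d, 3 * s := Finset.sum_le_sum fun i _ => ?_
      _ = _ := by simp
    have := hdiff i
    rw [hcell i, sub_self, sub_zero, abs_div, abs_of_pos hs, div_lt_iff₀ hs] at this
    exact this.le
  have h2 := mul_le_mul_of_nonneg_left (hsep a ha b hb hne) hα.le
  linarith [hlow (a - b)]

theorem add_mem_enlargedCell {d : ℕ} {s η M : ℝ} (hs : 0 < s) (hη : 0 < η)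
    (hηM : d * (η * M) ≤ s) (T : EuclideanSpace ℝ (Fin d) →ₗ[ℝ] EuclideanSpace ℝ (Fin d))
    (a v : EuclideanSpace ℝ (Fin d)) (ha : ‖a‖ ≤ M) :
    T a + v ∈ enlargedCell s fun i =>
      cellIndex s η (fun i j => ⌊T (EuclideanSpace.single j 1) i / η⌋) a i + ⌊v i / s⌋ := by
  intro i
  have h1 := abs_le.mp ((abs_apply_sub_discretized_le hη T a ha i).trans hηM)
  have hc : cellIndex s η (fun i j => ⌊T (EuclideanSpace.single j 1) i / η⌋) a i =
    ⌊(∑ j, (⌊T (EuclideanSpace.single j 1) i / η⌋ : ℝ) * η * a j) / s⌋ := rfl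
  set S := ∑ j, (⌊T (EuclideanSpace.single j 1) i / η⌋ : ℝ) * η * a j with hS
  have h2 := (le_div_iff₀ hs).mp (Int.floor_le (S / s))
  have h3 := (div_lt_iff₀ hs).mp (Int.lt_floor_add_one (S / s))
  have h4 := (le_div_iff₀ hs).mp (Int.floor_le (v i / s))
  have h5 := (div_lt_iff₀ hs).mp (Int.lt_floor_add_one (v i / s))
  simp only [PiLp.add_apply, hc]
  push_cast
  constructor <;> linarith [h1.1, h1.2]

theorem floor_mem_Icc_of_abs_le {x y : ℝ} (h : |x| ≤ y) :
    ⌊x⌋ ∈ Finset.Icc (-((⌊y⌋₊ + 1 : ℕ) : ℤ)) ((⌊y⌋₊ + 1 : ℕ) : ℤ) := by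
  have hy : y < ((⌊y⌋₊ + 1 : ℕ) : ℤ) := by
    push_cast
    exact Nat.lt_floor_add_one y
  obtain ⟨h1, h2⟩ := abs_le.mp h
  rw [Finset.mem_Icc]
  constructor
  · rw [Int.le_floor]
    push_cast at hy ⊢
    linarith
  · have h3 := (Int.floor_le x).trans (h2.trans hy.le)
    exact_mod_cast h3

/-- A large closed subset of the unit cube that contains no copy `T F + v` of a given finite set,
with `T` bounded above and below, provided `F` has many points relative to its separation. -/
theorem exists_closed_avoiding_finset {d : ℕ} (hd : 1 ≤ d) {α R σ M : ℝ} (hα0 : 0 < α)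
    (hα1 : α < 1) (hσ : 0 < σ) (hσM : σ ≤ 2 * M) (hMR : M ≤ R) {q : ℕ} (hq : 1 ≤ q)
    (hqα : 2 / (q : ℝ) * 35 ^ d < α) (F : Finset (EuclideanSpace ℝ (Fin d)))
    (hsep : ∀ x ∈ F, ∀ y ∈ F, x ≠ y → σ ≤ ‖x - y‖) (hM : ∀ z ∈ F, ‖z‖ ≤ M)
    (hF : ((8 * d ^ 2 * (1 + 2 * R) / α ^ 2 + 8) / (σ / M)) ^ (d * d + d) *
      (1 - 1 / (q : ℝ)) ^ F.card < 1 / 2) :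
    ∃ E : Set (EuclideanSpace ℝ (Fin d)), IsClosed E ∧ E ⊆ unitCube d ∧
      ENNReal.ofReal (1 - α) < volume E ∧
      ∀ (T : EuclideanSpace ℝ (Fin d) →ₗ[ℝ] EuclideanSpace ℝ (Fin d))
        (v : EuclideanSpace ℝ (Fin d)), (∀ u, α * ‖u‖ ≤ ‖T u‖) → (∀ u, ‖T u‖ ≤ 1 / α * ‖u‖) →
          ∃ a ∈ F, T a + v ∉ E := by
  classical
  have hd' : (1 : ℝ) ≤ d := by exact_mod_cast hd
  have hM0 : 0 < M := by linarith
  have hR0 : 0 < R := by linarith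
  set D : ℝ := 4 * d * (1 + 2 * R) with hD
  have hD0 : 0 < D := by positivity
  set s : ℝ := α * σ / D with hs_def
  have hs : 0 < s := by positivity
  have hs1 : s ≤ 1 := by
    rw [hs_def, div_le_one hD0]
    nlinarith
  set η : ℝ := s / (d * M) with hη_def
  have hη : 0 < η := by positivity
  have hηM : d * (η * M) ≤ s := by
    rw [hη_def]
    apply le_of_eq
    field_simp
  have hsσ : d * (3 * s) < α * σ := by
    have h1 : s * D = α * σ := by rw [hs_def]; field_simp
    have h2 : d * (3 * s) < s * D := by
      rw [hD]
      have : 0 < d * s := by positivity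
      nlinarith [mul_pos this hR0]
    linarith
  set K : ℕ := ⌊1 / (α * η)⌋₊ + 1 with hK
  set m : ℕ := ⌊2 * M / (α * s)⌋₊ + 4 with hm
  have : NeZero m := ⟨by omega⟩
  have hm3 : 2 * M / (α * s) + 3 ≤ m := by
    have := Nat.lt_floor_add_one (2 * M / (α * s))
    rw [hm]
    push_cast
    linarith
  set X : ℝ := M / σ with hX
  have hX2 : 1 / 2 ≤ X := by
    rw [hX, le_div_iff₀ hσ]
    linarith
  set C : ℝ := 8 * d ^ 2 * (1 + 2 * R) / α ^ 2 + 8 with hC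
  have hmC : (m : ℝ) ≤ C * X := by
    have h1 : 2 * M / (α * s) = 8 * d * (1 + 2 * R) / α ^ 2 * X := by
      rw [hs_def, hX, hD]
      field_simp
      ring
    have h2 : (m : ℝ) ≤ 2 * M / (α * s) + 4 := by
      rw [hm]
      push_cast
      linarith [Nat.floor_le (by positivity : 0 ≤ 2 * M / (α * s))]
    have h3 : 8 * d * (1 + 2 * R) / α ^ 2 ≤ 8 * d ^ 2 * (1 + 2 * R) / α ^ 2 := by
      gcongr
      nlinarith
    have := mul_le_mul_of_nonneg_right h3 (by linarith : 0 ≤ X)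
    rw [hC]
    linarith
  have hKC : ((2 * K + 1 : ℕ) : ℝ) ≤ C * X := by
    have h1 : 2 * (1 / (α * η)) = 8 * d ^ 2 * (1 + 2 * R) / α ^ 2 * X := by
      rw [hη_def, hs_def, hX, hD]
      field_simp
      ring
    have h2 := Nat.floor_le (by positivity : 0 ≤ 1 / (α * η))
    rw [hK, hC]
    push_cast
    linarith
  let ι := (Fin d → Fin d → Finset.Icc (-(K : ℤ)) K) × (Fin d → ZMod m)
  let f : ι → Finset (Fin d → ZMod m) := fun p =>
    F.image fun a i => (cellIndex s η (fun i j => (p.1 i j : ℤ)) a i : ZMod m) + p.2 i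
  have hcard : (Fintype.card ι : ℝ) ≤ (C / (σ / M)) ^ (d * d + d) := by
    have h1 : Fintype.card ι = (2 * K + 1) ^ (d * d) * m ^ d := by
      have h2 : ((K : ℤ) + 1 - -(K : ℤ)).toNat = 2 * K + 1 := by omega
      simp only [ι, Fintype.card_prod, Fintype.card_pi, Fintype.card_coe, Int.card_Icc, h2,
        ZMod.card, Finset.prod_const, Finset.card_univ, Fintype.card_fin, pow_mul]
    have h3 : C / (σ / M) = C * X := by rw [hX]; field_simp
    rw [h1, h3, pow_add]
    push_cast at hKC ⊢
    gcongr
  have hq1 : (1 : ℝ) / q ≤ 1 := by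
    rw [div_le_one (by exact_mod_cast hq)]
    exact_mod_cast hq
  have hsmall : (Fintype.card ι : ℝ) * (1 - 1 / (q : ℝ)) ^ F.card < 1 / 2 :=
    (mul_le_mul_of_nonneg_right hcard (pow_nonneg (by linarith) _)).trans_lt hF
  obtain ⟨W, hW, hhit⟩ := exists_sparse_hitting_set q F.card hq f (cubeCells d s)
    (cubeCells_nonempty hs) (fun z i => (z i : ZMod m)) hsmall
  refine ⟨unitCube d \ ⋃ z ∈ (cubeCells d s).filter fun z => (fun i => (z i : ZMod m)) ∈ W,
    enlargedCell s z, ?_, sdiff_subset, ?_, ?_⟩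
  · exact (isClosed_unitCube d).sdiff
      (isOpen_biUnion fun z _ => isOpen_enlargedCell s z)
  · exact lt_volume_unitCube_diff hs hs1 hα1 _ hW (by positivity) hqα
  · intro T v hlow hup
    have hk : ∀ i j, ⌊T (EuclideanSpace.single j 1) i / η⌋ ∈ Finset.Icc (-(K : ℤ)) K := by
      intro i j
      refine floor_mem_Icc_of_abs_le ?_
      rw [abs_div, abs_of_pos hη, div_le_iff₀ hη]
      have h1 := (EuclideanSpace.abs_apply_le_norm _ i).trans (hup (EuclideanSpace.single j 1))
      simp only [PiLp.norm_single, norm_one, mul_one] at h1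
      refine h1.trans (le_of_eq ?_)
      field_simp
    let p : ι := (fun i j => ⟨_, hk i j⟩, fun i => ((⌊v i / s⌋ : ℤ) : ZMod m))
    have hinj := cellIndex_mod_injOn hs hη hα0 hηM hsσ hm3 F hsep hM T hlow hup p.2
    obtain ⟨w, hwf, hwW⟩ := hhit p (Finset.card_image_of_injOn hinj).ge
    obtain ⟨a, haF, rfl⟩ := Finset.mem_image.mp hwf
    refine ⟨a, haF, fun hmem => hmem.2 ?_⟩
    have hcell := add_mem_enlargedCell hs hη hηM T a v (hM a haF)
    refine Set.mem_biUnion (Finset.mem_coe.mpr (Finset.mem_filter.mpr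
      ⟨mem_cubeCells hs hmem.1 hcell, ?_⟩)) hcell
    push_cast
    exact hwW

/-- If `A ⊆ ℝ^d` is bounded, infinite, contains `0`, and admits finite subsets
`A_n ⊆ A ∖ {0}` with `#A_n → ∞` and `(−log δ(A_n))/#A_n → 0`, then for every
`0 < α < 1` there is a closed set `E_α ⊆ [0,1]^d` with `μ(E_α) > 1 − α` such that
`T A + x ⊄ E_α` for every `T ∈ S_α^{1/α}` and every `x ∈ ℝ^d`. -/
theorem stmt17 (d : ℕ) (hd : 1 ≤ d) (A : Set (EuclideanSpace ℝ (Fin d)))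
    (hbdd : Bornology.IsBounded A) (hinf : A.Infinite)
    (h0A : (0 : EuclideanSpace ℝ (Fin d)) ∈ A)
    (An : ℕ → Set (EuclideanSpace ℝ (Fin d)))
    (hfin : ∀ n, (An n).Finite) (hsub : ∀ n, An n ⊆ A \ {0})
    (hcard2 : ∀ n, 2 ≤ (An n).ncard)
    (hcard : Tendsto (fun n => (An n).ncard) atTop atTop)
    (hlog : Tendsto (fun n => -Real.log (delta (An n)) / ((An n).ncard : ℝ))
      atTop (nhds 0)) :
    ∀ α : ℝ, 0 < α → α < 1 →
      ∃ E : Set (EuclideanSpace ℝ (Fin d)), IsClosed E ∧ E ⊆ unitCube d ∧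
        ENNReal.ofReal (1 - α) < volume E ∧
        ∀ (T : EuclideanSpace ℝ (Fin d) ≃ₗ[ℝ] EuclideanSpace ℝ (Fin d))
          (v : EuclideanSpace ℝ (Fin d)),
          memS α (1 / α) T → ¬ ((fun a => T a + v) '' A ⊆ E) := by
  intro α hα0 hα1
  obtain ⟨R, hR⟩ := hbdd.exists_norm_le
  choose σ M hσ hM hσM hδ hsep hle hmax using fun n => exists_separation_radius (hfin n) (hcard2 n)
  have hMR : ∀ n, M n ≤ R := fun n => by
    obtain ⟨z, hz, h⟩ := hmax n
    exact h ▸ hR z (hsub n hz).1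
  have hR0 : 0 < R := (hM 0).trans_le (hMR 0)
  obtain ⟨q, hq⟩ := exists_nat_gt (2 * 35 ^ d / α)
  have hq2 : (1 : ℝ) < q := by
    have h1 : (1 : ℝ) ≤ 35 ^ d := one_le_pow₀ (by norm_num)
    have h2 : (1 : ℝ) < 2 * 35 ^ d / α := by
      rw [lt_div_iff₀ hα0]
      linarith
    linarith
  have hq0 : (0 : ℝ) < q := by linarith
  have hqα : 2 / (q : ℝ) * 35 ^ d < α := by
    rw [div_lt_iff₀ hα0] at hq
    rw [div_mul_eq_mul_div, div_lt_iff₀ hq0]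
    linarith
  have hρ0 : (0 : ℝ) < 1 - 1 / q := by
    have := (div_lt_one hq0).mpr hq2
    linarith
  have hρ1 : 1 - 1 / (q : ℝ) < 1 := by
    have : (0 : ℝ) < 1 / q := by positivity
    linarith
  have hC : 0 < 8 * (d : ℝ) ^ 2 * (1 + 2 * R) / α ^ 2 + 8 := by positivity
  obtain ⟨n, hn⟩ := (eventually_pow_mul_pow_lt_half
    (fun n => by rw [hδ n]; exact div_pos (hσ n) (hM n)) hcard hlog hC hρ0 hρ1
    (d * d + d)).exists
  rw [hδ n, Set.ncard_eq_toFinset_card _ (hfin n)] at hn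
  obtain ⟨E, hclosed, hcube, hvol, havoid⟩ := exists_closed_avoiding_finset hd hα0 hα1 (hσ n)
    (hσM n) (hMR n) (by exact_mod_cast hq2.le) hqα (hfin n).toFinset
    (by simpa using hsep n) (by simpa using hle n) hn
  refine ⟨E, hclosed, hcube, hvol, fun T v hT hE => ?_⟩
  obtain ⟨a, ha, hna⟩ := havoid T v (fun u => (norm_apply_bounds hT.1 hT.2 u).1)
    fun u => (norm_apply_bounds hT.1 hT.2 u).2
  exact hna (hE ⟨a, (hsub n ((hfin n).mem_toFinset.mp ha)).1, rfl⟩)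
end
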